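/- arXiv:1308.3895 — 2 statements merged into one kernel-verified Lean document; each statement's English description precedes it below -/
import Mathlib

section
/- First-order energy estimate (k = 1 case of Theorem 4.1): Fix ω ∈ ℝ, β ∈ (0,1), and an even real-valued Schwartz function V on ℝ, and set α = ‖V‖²_{L¹(ℝ)}. For every N ≥ 2 and every symmetric Schwartz function ψ on ℝ^N, one has Re ⟨ψ, (H_N + N α + N) ψ⟩ ≥ (N/2) · Re ⟨ψ, S₁² ψ⟩. -/
open MeasureTheory Complex
open scoped BigOperators

noncomputable section

/-- Second partial derivative `∂²_{x_j} ψ` of a function of `N` real variables. -/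
def d2 {N : ℕ} (j : Fin N) (ψ : (Fin N → ℝ) → ℂ) : (Fin N → ℝ) → ℂ :=
  fun x => iteratedDeriv 2 (fun t => ψ (Function.update x j t)) (x j)

/-- The one-particle operator `S_j² ψ = ψ - ½ ∂²_{x_j} ψ + ½ ω² x_j² ψ`. -/
def Ssq {N : ℕ} (ω : ℝ) (j : Fin N) (ψ : (Fin N → ℝ) → ℂ) : (Fin N → ℝ) → ℂ :=
  fun x => ψ x - (1/2 : ℂ) * d2 j ψ x + (1/2 : ℂ) * (ω : ℂ) ^ 2 * ((x j : ℝ) : ℂ) ^ 2 * ψ x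

/-- The `N`-body Hamiltonian
`H_N ψ = Σ_j (-½ ∂²_{x_j} ψ + ½ ω² x_j² ψ)
  + (1/N) Σ_{i<j} N^β V(N^β (x_i - x_j)) ψ`. -/
def HamN (ω β : ℝ) (V : ℝ → ℝ) (N : ℕ) (ψ : (Fin N → ℝ) → ℂ) : (Fin N → ℝ) → ℂ :=
  fun x =>
    (∑ j : Fin N, (-(1/2 : ℂ) * d2 j ψ x + (1/2 : ℂ) * (ω : ℂ) ^ 2 * ((x j : ℝ) : ℂ) ^ 2 * ψ x))
    + ((N : ℂ))⁻¹ * ∑ p : Fin N × Fin N,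
        if p.1 < p.2 then
          (((N : ℝ) ^ β * V ((N : ℝ) ^ β * (x p.1 - x p.2)) : ℝ) : ℂ) * ψ x
        else 0

/-- `H_N + c·Id`. -/
def HamPlus (ω β : ℝ) (V : ℝ → ℝ) (N : ℕ) (c : ℝ) (ψ : (Fin N → ℝ) → ℂ) :
    (Fin N → ℝ) → ℂ :=
  fun x => HamN ω β V N ψ x + (c : ℂ) * ψ x

/-- The product `S₁² S₂² ⋯ S_k²` (composition of the pairwise commuting operators `S_j²`
for the first `k` coordinates). -/
def Sprod (ω : ℝ) (N : ℕ) : ℕ → ((Fin N → ℝ) → ℂ) → ((Fin N → ℝ) → ℂ)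
  | 0, ψ => ψ
  | (k+1), ψ => if h : k < N then Ssq ω ⟨k, h⟩ (Sprod ω N k ψ) else Sprod ω N k ψ

/-- The real part of the `L²(ℝ^N)` inner product `⟨ψ, f⟩ = ∫ conj(ψ) f`. -/
def reInner {N : ℕ} (ψ f : (Fin N → ℝ) → ℂ) : ℝ :=
  (∫ x : Fin N → ℝ, (starRingEnd ℂ) (ψ x) * f x).re

/-- A function of `N` variables is symmetric if it is invariant under permutations of its
arguments. -/
def IsSymmetricFn {N : ℕ} (ψ : (Fin N → ℝ) → ℂ) : Prop :=
  ∀ (σ : Equiv.Perm (Fin N)) (x : Fin N → ℝ), ψ (x ∘ σ) = ψ x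

open scoped LineDeriv in
/-- The `j`-th partial derivative of a Schwartz function. -/
def partialDeriv {N : ℕ} (j : Fin N) (ψ : SchwartzMap (Fin N → ℝ) ℂ) :
    SchwartzMap (Fin N → ℝ) ℂ :=
  ∂_{(Pi.single j 1 : Fin N → ℝ)} ψ

theorem partialDeriv_apply {N : ℕ} (j : Fin N) (ψ : SchwartzMap (Fin N → ℝ) ℂ)
    (x : Fin N → ℝ) : partialDeriv j ψ x = fderiv ℝ ψ x (Pi.single j 1) :=
  SchwartzMap.lineDerivOp_apply_eq_fderiv _ _ _

theorem hasLineDerivAt_partialDeriv {N : ℕ} (j : Fin N) (ψ : SchwartzMap (Fin N → ℝ) ℂ)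
    (x : Fin N → ℝ) : HasLineDerivAt ℝ ψ (partialDeriv j ψ x) x (Pi.single j 1) := by
  rw [partialDeriv_apply]
  exact (ψ.differentiableAt (x := x)).hasFDerivAt.hasLineDerivAt _

theorem hasDerivAt_comp_update {N : ℕ} (j : Fin N) (ψ : SchwartzMap (Fin N → ℝ) ℂ)
    (x : Fin N → ℝ) (t : ℝ) :
    HasDerivAt (fun s => ψ (Function.update x j s)) (partialDeriv j ψ (Function.update x j t)) t := by
  rw [partialDeriv_apply]
  exact (ψ.differentiableAt (x := Function.update x j t)).hasFDerivAt.comp_hasDerivAt t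
    (hasDerivAt_update x j t)

theorem d2_eq_partialDeriv {N : ℕ} (j : Fin N) (ψ : SchwartzMap (Fin N → ℝ) ℂ) :
    d2 j ψ = partialDeriv j (partialDeriv j ψ) := by
  funext x
  have h : deriv (fun s => ψ (Function.update x j s)) =
      fun s => partialDeriv j ψ (Function.update x j s) :=
    funext fun t => (hasDerivAt_comp_update j ψ x t).deriv
  rw [d2, iteratedDeriv_succ, iteratedDeriv_one, h, (hasDerivAt_comp_update j _ x (x j)).deriv,
    Function.update_eq_self]

theorem integrable_norm_mul_norm {N : ℕ} (φ χ : SchwartzMap (Fin N → ℝ) ℂ) :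
    Integrable fun x => ‖φ x‖ * ‖χ x‖ :=
  χ.integrable.norm.bdd_mul (c := SchwartzMap.seminorm ℝ 0 0 φ)
    φ.continuous.norm.aestronglyMeasurable
    (.of_forall fun x => by simpa using SchwartzMap.norm_le_seminorm ℝ φ x)

theorem integrable_norm_sq {N : ℕ} (φ : SchwartzMap (Fin N → ℝ) ℂ) :
    Integrable fun x => ‖φ x‖ ^ 2 := by
  simpa only [sq] using integrable_norm_mul_norm φ φ

theorem integrable_inner {N : ℕ} (φ χ : SchwartzMap (Fin N → ℝ) ℂ) :
    Integrable fun x => inner ℝ (φ x) (χ x) :=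
  (integrable_norm_mul_norm φ χ).mono' (φ.continuous.inner χ.continuous).aestronglyMeasurable
    (.of_forall fun _ => norm_inner_le_norm _ _)

theorem integrable_sq_mul_norm_sq {N : ℕ} (j : Fin N) (ψ : SchwartzMap (Fin N → ℝ) ℂ) :
    Integrable fun x => x j ^ 2 * ‖ψ x‖ ^ 2 := by
  refine ((ψ.integrable_pow_mul volume 2).const_mul (SchwartzMap.seminorm ℝ 0 0 ψ)).mono'
    (Continuous.aestronglyMeasurable (by fun_prop)) (.of_forall fun x => ?_)
  have h1 : |x j| ≤ ‖x‖ := norm_le_pi_norm x j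
  have h2 := SchwartzMap.norm_le_seminorm ℝ ψ x
  have h3 : x j ^ 2 ≤ ‖x‖ ^ 2 := sq_le_sq.2 (by simpa using h1)
  rw [Real.norm_of_nonneg (by positivity), sq ‖ψ x‖]
  calc x j ^ 2 * (‖ψ x‖ * ‖ψ x‖) ≤ ‖x‖ ^ 2 * (SchwartzMap.seminorm ℝ 0 0 ψ * ‖ψ x‖) := by gcongr
    _ = _ := by ring

theorem integral_inner_d2 {N : ℕ} (j : Fin N) (ψ : SchwartzMap (Fin N → ℝ) ℂ) :
    ∫ x, inner ℝ (ψ x) (d2 j ψ x) = -∫ x, ‖partialDeriv j ψ x‖ ^ 2 := by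
  rw [d2_eq_partialDeriv]
  have h := SchwartzMap.integral_bilinear_lineDerivOp_right_eq_neg_left (μ := volume) ψ
    (partialDeriv j ψ) (innerSL ℝ) (Pi.single j 1)
  simp only [← real_inner_self_eq_norm_sq]
  exact h

theorem abs_intervalIntegral_le_integral_abs (V : SchwartzMap ℝ ℝ) (t : ℝ) :
    |∫ s in (0 : ℝ)..t, V s| ≤ ∫ s, |V s| :=
  (intervalIntegral.norm_integral_le_integral_norm_uIoc).trans
    (setIntegral_le_integral V.integrable.norm (.of_forall fun _ => norm_nonneg _))

/-- Multiplication by a rescaled pair potential is form bounded by the kinetic energy, uniformly in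
the scaling parameter. -/
theorem abs_integral_pair_le {N : ℕ} {i j : Fin N} (hij : i ≠ j) (b : ℝ) (V : SchwartzMap ℝ ℝ)
    (ψ : SchwartzMap (Fin N → ℝ) ℂ) :
    |∫ x : Fin N → ℝ, b * V (b * (x i - x j)) * ‖ψ x‖ ^ 2| ≤
      1 / 2 * (∫ x, ‖partialDeriv i ψ x‖ ^ 2) + 2 * (∫ s, |V s|) ^ 2 * ∫ x, ‖ψ x‖ ^ 2 := by
  set a := ∫ s, |V s|
  let G : ℝ → ℝ := fun t => ∫ s in (0 : ℝ)..t, V s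
  have hGd (t : ℝ) : HasDerivAt G (V t) t :=
    intervalIntegral.integral_hasDerivAt_right (V.continuous.intervalIntegrable _ _)
      V.continuous.stronglyMeasurable.stronglyMeasurableAtFilter V.continuous.continuousAt
  have hGc : Continuous G := continuous_iff_continuousAt.2 fun t => (hGd t).continuousAt
  have hGb (t : ℝ) : |G t| ≤ a := abs_intervalIntegral_le_integral_abs V t
  have hψ := integrable_norm_sq ψ
  have hD := integrable_norm_sq (partialDeriv i ψ)
  have hibp : ∫ x : Fin N → ℝ, ‖ψ x‖ ^ 2 * (b * V (b * (x i - x j))) =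
      -∫ x : Fin N → ℝ, 2 * inner ℝ (ψ x) (partialDeriv i ψ x) * G (b * (x i - x j)) := by
    refine integral_bilinear_hasLineDerivAt_right_eq_neg_left_of_integrable
      (B := ContinuousLinearMap.mul ℝ ℝ) (v := Pi.single i 1) (f := fun x => ‖ψ x‖ ^ 2)
      (g := fun x => G (b * (x i - x j))) ?_ ?_ ?_ ?_ ?_
    · exact ((integrable_inner ψ _).const_mul 2).mul_bdd (c := a)
        (Continuous.aestronglyMeasurable (by fun_prop)) (.of_forall fun x => hGb _)
    · refine hψ.mul_bdd (c := |b| * SchwartzMap.seminorm ℝ 0 0 V)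
        (Continuous.aestronglyMeasurable (by fun_prop)) (.of_forall fun x => ?_)
      rw [norm_mul, Real.norm_eq_abs b]
      gcongr
      exact SchwartzMap.norm_le_seminorm ℝ V _
    · exact hψ.mul_bdd (c := a)
        (Continuous.aestronglyMeasurable (by fun_prop)) (.of_forall fun x => hGb _)
    · intro x _
      have h : HasDerivAt (fun t : ℝ => ψ (x + t • Pi.single i 1)) (partialDeriv i ψ x) 0 :=
        hasLineDerivAt_partialDeriv i ψ x
      simpa [HasLineDerivAt] using h.norm_sq
    · intro x _
      have h1 : HasDerivAt (fun t : ℝ => b * ((x + t • (Pi.single i 1 : Fin N → ℝ)) i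
          - (x + t • (Pi.single i 1 : Fin N → ℝ)) j)) b 0 := by
        simpa [hij, hij.symm] using
          ((((hasDerivAt_id (0 : ℝ)).const_add (x i)).sub_const (x j)).const_mul b)
      have h2 := (hGd _).comp (0 : ℝ) h1
      simpa [HasLineDerivAt, mul_comm, Function.comp_def] using h2
  simp_rw [mul_comm (‖ψ _‖ ^ 2)] at hibp
  rw [hibp, abs_neg, ← integral_const_mul, ← integral_const_mul,
    ← integral_add (hD.const_mul _) (hψ.const_mul _)]
  have hbound : Integrable fun x =>
      1 / 2 * ‖partialDeriv i ψ x‖ ^ 2 + 2 * a ^ 2 * ‖ψ x‖ ^ 2 :=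
    (hD.const_mul _).add (hψ.const_mul _)
  rw [← Real.norm_eq_abs]
  refine norm_integral_le_of_norm_le hbound (.of_forall fun x => ?_)
  have h1 := abs_real_inner_le_norm (ψ x) (partialDeriv i ψ x)
  have h2 := hGb (b * (x i - x j))
  rw [Real.norm_eq_abs, abs_mul, abs_mul, abs_two]
  have h3 : |inner ℝ (ψ x) (partialDeriv i ψ x)| * |G (b * (x i - x j))| ≤
      ‖ψ x‖ * ‖partialDeriv i ψ x‖ * a := by gcongr
  have h4 := sq_nonneg (‖partialDeriv i ψ x‖ - 2 * a * ‖ψ x‖)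
  nlinarith

theorem IsSymmetricFn.d2_comp_perm {N : ℕ} {ψ : (Fin N → ℝ) → ℂ} (hsym : IsSymmetricFn ψ)
    (σ : Equiv.Perm (Fin N)) (j : Fin N) (x : Fin N → ℝ) :
    d2 j ψ (x ∘ σ) = d2 (σ j) ψ x := by
  have h (t : ℝ) : ψ (Function.update (x ∘ σ) j t) = ψ (Function.update x (σ j) t) := by
    rw [← hsym σ (Function.update x (σ j) t), Function.update_comp_eq_of_injective _ σ.injective]
  simp only [d2, h, Function.comp_apply]

theorem integral_comp_perm {N : ℕ} (σ : Equiv.Perm (Fin N)) (f : (Fin N → ℝ) → ℝ) :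
    ∫ x, f (x ∘ σ) = ∫ x, f x := by
  have h := volume_measurePreserving_piCongrLeft (fun _ : Fin N => ℝ) σ.symm
  rw [← h.integral_comp' f]
  congr 1 with x
  congr 1 with k
  have := MeasurableEquiv.piCongrLeft_apply_apply (β := fun _ : Fin N => ℝ) σ.symm x (σ k)
  simpa using this.symm

theorem IsSymmetricFn.integral_sq_mul_norm_sq {N : ℕ} {ψ : (Fin N → ℝ) → ℂ}
    (hsym : IsSymmetricFn ψ) (i j : Fin N) :
    ∫ x, x i ^ 2 * ‖ψ x‖ ^ 2 = ∫ x, x j ^ 2 * ‖ψ x‖ ^ 2 := by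
  rw [← integral_comp_perm (Equiv.swap i j)]
  simp [hsym _ _]

theorem IsSymmetricFn.integral_norm_partialDeriv_sq {N : ℕ} {ψ : SchwartzMap (Fin N → ℝ) ℂ}
    (hsym : IsSymmetricFn ψ) (i j : Fin N) :
    ∫ x, ‖partialDeriv i ψ x‖ ^ 2 = ∫ x, ‖partialDeriv j ψ x‖ ^ 2 := by
  rw [← neg_inj, ← integral_inner_d2, ← integral_inner_d2,
    ← integral_comp_perm (Equiv.swap i j)]
  simp [hsym _ _, hsym.d2_comp_perm]

theorem reInner_neg_half_sum_d2_add_mul {N : ℕ} (ψ : SchwartzMap (Fin N → ℝ) ℂ)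
    (s : Finset (Fin N)) {q : (Fin N → ℝ) → ℝ} (hq : Integrable fun x => q x * ‖ψ x‖ ^ 2) :
    reInner ψ (fun x => -(1 / 2 : ℂ) * ∑ j ∈ s, d2 j ψ x + (q x : ℂ) * ψ x) =
      1 / 2 * ∑ j ∈ s, (∫ x, ‖partialDeriv j ψ x‖ ^ 2) + ∫ x, q x * ‖ψ x‖ ^ 2 := by
  have hd (j : Fin N) : Integrable fun x => (starRingEnd ℂ) (ψ x) * d2 j ψ x := by
    rw [d2_eq_partialDeriv]
    exact (integrable_norm_mul_norm ψ (partialDeriv j (partialDeriv j ψ))).mono'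
      (Continuous.aestronglyMeasurable (by fun_prop)) (.of_forall fun x => by simp)
  have hdre (j : Fin N) : (∫ x, (starRingEnd ℂ) (ψ x) * d2 j ψ x).re =
      -∫ x, ‖partialDeriv j ψ x‖ ^ 2 := by
    rw [← integral_inner_d2, ← Complex.reCLM_apply, ← Complex.reCLM.integral_comp_comm (hd j)]
    congr 1 with x
    simp [Complex.inner, mul_comm]
  have hsplit (x : Fin N → ℝ) : (starRingEnd ℂ) (ψ x) *
      (-(1 / 2 : ℂ) * ∑ j ∈ s, d2 j ψ x + (q x : ℂ) * ψ x) =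
      ((-(1 / 2) : ℝ) : ℂ) * ∑ j ∈ s, (starRingEnd ℂ) (ψ x) * d2 j ψ x +
        ((q x * ‖ψ x‖ ^ 2 : ℝ) : ℂ) := by
    rw [← Finset.mul_sum]
    push_cast
    rw [← Complex.conj_mul' (ψ x)]
    ring
  have hqC : Integrable fun x => ((q x * ‖ψ x‖ ^ 2 : ℝ) : ℂ) := hq.ofReal
  have hdsum := (integrable_finsetSum s fun j _ => hd j).const_mul ((-(1 / 2) : ℝ) : ℂ)
  simp_rw [reInner, hsplit]
  rw [integral_add hdsum hqC, integral_const_mul, integral_finsetSum _ fun j _ => hd j,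
    integral_complex_ofReal, Complex.add_re,
    Complex.re_ofReal_mul, Complex.re_sum, Complex.ofReal_re]
  simp [hdre]

theorem two_mul_card_filter_lt_le (N : ℕ) :
    2 * (Finset.univ.filter fun p : Fin N × Fin N => p.1 < p.2).card ≤ N ^ 2 := by
  have h1 : (Finset.univ.filter fun p : Fin N × Fin N => p.2 < p.1).card =
      (Finset.univ.filter fun p : Fin N × Fin N => p.1 < p.2).card :=
    Finset.card_equiv (Equiv.prodComm _ _) (by simp)
  have h2 : Disjoint (Finset.univ.filter fun p : Fin N × Fin N => p.1 < p.2)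
      (Finset.univ.filter fun p : Fin N × Fin N => p.2 < p.1) :=
    Finset.disjoint_filter.2 fun p _ h => h.asymm
  have h3 := Finset.card_le_univ (Finset.disjUnion _ _ h2)
  rw [Finset.card_disjUnion, h1] at h3
  simpa [two_mul, sq] using h3

/-- **First-order energy estimate** (the `k = 1` case of Theorem 4.1): with `α = ‖V‖²_{L¹}`,
for every `N ≥ 2` and every symmetric Schwartz `ψ`,
`Re ⟨ψ, (H_N + Nα + N) ψ⟩ ≥ (N/2) Re ⟨ψ, S₁² ψ⟩`. -/
theorem energy_estimate_first_order (ω β : ℝ) (hβ0 : 0 < β) (hβ1 : β < 1)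
    (V : SchwartzMap ℝ ℝ) (hVeven : ∀ x : ℝ, V (-x) = V x)
    (N : ℕ) (hN : 2 ≤ N) (ψ : SchwartzMap (Fin N → ℝ) ℂ) (hsym : IsSymmetricFn ⇑ψ) :
    (N : ℝ) / 2 * reInner ⇑ψ (Ssq ω (⟨0, by omega⟩ : Fin N) ⇑ψ)
      ≤ reInner ⇑ψ
        (HamPlus ω β ⇑V N ((N : ℝ) * (∫ x : ℝ, |V x|) ^ 2 + (N : ℝ)) ⇑ψ) := by
  generalize (⟨0, by omega⟩ : Fin N) = o
  set m := ∫ x, ‖ψ x‖ ^ 2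
  set a := ∫ x, |V x|
  set D := ∫ x, ‖partialDeriv o ψ x‖ ^ 2
  set P := ∫ x, x o ^ 2 * ‖ψ x‖ ^ 2
  have hN0 : (0 : ℝ) < N := by positivity
  have hψ := integrable_norm_sq ψ
  have hx := fun j : Fin N => integrable_sq_mul_norm_sq j ψ
  have hm0 : 0 ≤ m := integral_nonneg fun x => by positivity
  have hD0 : 0 ≤ D := integral_nonneg fun x => by positivity
  have hP0 : 0 ≤ P := integral_nonneg fun x => by positivity
  set b : ℝ := (N : ℝ) ^ β
  have hpair (p : Fin N × Fin N) :
      Integrable fun x : Fin N → ℝ => b * V (b * (x p.1 - x p.2)) * ‖ψ x‖ ^ 2 := by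
    refine hψ.bdd_mul (c := |b| * SchwartzMap.seminorm ℝ 0 0 V)
      (Continuous.aestronglyMeasurable (by fun_prop)) (.of_forall fun x => ?_)
    rw [norm_mul, Real.norm_eq_abs b]
    gcongr
    exact SchwartzMap.norm_le_seminorm ℝ V _
  have hS : reInner ψ (Ssq ω o ψ) = m + 1 / 2 * D + 1 / 2 * ω ^ 2 * P := by
    have hq (x : Fin N → ℝ) : (1 + 1 / 2 * ω ^ 2 * x o ^ 2) * ‖ψ x‖ ^ 2 =
        ‖ψ x‖ ^ 2 + 1 / 2 * ω ^ 2 * (x o ^ 2 * ‖ψ x‖ ^ 2) := by ring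
    have h := reInner_neg_half_sum_d2_add_mul ψ {o} (q := fun x => 1 + 1 / 2 * ω ^ 2 * x o ^ 2)
      (by simp_rw [hq]; exact hψ.add ((hx o).const_mul _))
    simp_rw [hq, Finset.sum_singleton] at h
    rw [integral_add hψ ((hx o).const_mul _), integral_const_mul] at h
    rw [show Ssq ω o ψ = fun x => -(1 / 2 : ℂ) * d2 o ψ x +
      ((1 + 1 / 2 * ω ^ 2 * x o ^ 2 : ℝ) : ℂ) * ψ x by funext x; simp only [Ssq]; push_cast; ring, h]
    ring
  set L := Finset.univ.filter fun p : Fin N × Fin N => p.1 < p.2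
  set c : ℝ := (N : ℝ) * a ^ 2 + N
  have hH : reInner ψ (HamPlus ω β V N c ψ) = N * (1 / 2 * D + 1 / 2 * ω ^ 2 * P) +
      (N : ℝ)⁻¹ * ∑ p ∈ L, (∫ x : Fin N → ℝ, b * V (b * (x p.1 - x p.2)) * ‖ψ x‖ ^ 2) + c * m := by
    have hq (x : Fin N → ℝ) : (1 / 2 * ω ^ 2 * ∑ j, x j ^ 2 +
        (N : ℝ)⁻¹ * ∑ p ∈ L, b * V (b * (x p.1 - x p.2)) + c) * ‖ψ x‖ ^ 2 =
        1 / 2 * ω ^ 2 * ∑ j, x j ^ 2 * ‖ψ x‖ ^ 2 +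
          (N : ℝ)⁻¹ * ∑ p ∈ L, b * V (b * (x p.1 - x p.2)) * ‖ψ x‖ ^ 2 + c * ‖ψ x‖ ^ 2 := by
      simp_rw [← Finset.sum_mul]
      ring
    have hi1 := (integrable_finsetSum Finset.univ fun j _ => hx j).const_mul (1 / 2 * ω ^ 2)
    have hi2 := (integrable_finsetSum L fun p _ => hpair p).const_mul (N : ℝ)⁻¹
    have hi12 : Integrable fun x : Fin N → ℝ => 1 / 2 * ω ^ 2 * ∑ j, x j ^ 2 * ‖ψ x‖ ^ 2 +
        (N : ℝ)⁻¹ * ∑ p ∈ L, b * V (b * (x p.1 - x p.2)) * ‖ψ x‖ ^ 2 := hi1.add hi2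
    have h := reInner_neg_half_sum_d2_add_mul ψ Finset.univ
      (q := fun x => 1 / 2 * ω ^ 2 * ∑ j, x j ^ 2 +
        (N : ℝ)⁻¹ * ∑ p ∈ L, b * V (b * (x p.1 - x p.2)) + c)
      (by simp_rw [hq]; exact hi12.add (hψ.const_mul c))
    simp_rw [hq] at h
    rw [integral_add hi12 (hψ.const_mul c), integral_add hi1 hi2, integral_const_mul,
      integral_const_mul, integral_const_mul, integral_finsetSum _ fun j _ => hx j,
      integral_finsetSum _ fun p _ => hpair p,
      Finset.sum_congr rfl fun j _ => hsym.integral_norm_partialDeriv_sq j o,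
      Finset.sum_congr rfl fun j _ => hsym.integral_sq_mul_norm_sq j o, Finset.sum_const,
      Finset.sum_const, Finset.card_univ, Fintype.card_fin, nsmul_eq_mul, nsmul_eq_mul] at h
    rw [show HamPlus ω β V N c ψ = fun x => -(1 / 2 : ℂ) * ∑ j, d2 j ψ x +
      ((1 / 2 * ω ^ 2 * ∑ j, x j ^ 2 +
        (N : ℝ)⁻¹ * ∑ p ∈ L, b * V (b * (x p.1 - x p.2)) + c : ℝ) : ℂ) * ψ x by
        funext x
        simp only [HamPlus, HamN, ← Finset.sum_filter, ← Finset.sum_mul, Finset.sum_add_distrib,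
          ← Finset.mul_sum]
        push_cast
        simp only [← Finset.mul_sum]
        ring, h]
    ring
  have hlow : ∀ p ∈ L, -(1 / 2 * D + 2 * a ^ 2 * m) ≤
      ∫ x : Fin N → ℝ, b * V (b * (x p.1 - x p.2)) * ‖ψ x‖ ^ 2 := by
    intro p hp
    have h := abs_integral_pair_le (Finset.mem_filter.1 hp).2.ne b V ψ
    rw [hsym.integral_norm_partialDeriv_sq p.1 o] at h
    exact (abs_le.1 h).1
  have hsum := Finset.card_nsmul_le_sum L _ _ hlow
  rw [nsmul_eq_mul] at hsum
  have hcard : 2 * (L.card : ℝ) ≤ (N : ℝ) ^ 2 := by exact_mod_cast two_mul_card_filter_lt_le N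
  have hB : 0 ≤ 1 / 2 * D + 2 * a ^ 2 * m := by positivity
  have hint : -(N / 2 * (1 / 2 * D + 2 * a ^ 2 * m)) ≤ (N : ℝ)⁻¹ *
      ∑ p ∈ L, (∫ x : Fin N → ℝ, b * V (b * (x p.1 - x p.2)) * ‖ψ x‖ ^ 2) := by
    rw [inv_mul_eq_div, le_div_iff₀ hN0]
    nlinarith [mul_le_mul_of_nonneg_right hcard hB]
  rw [hS, hH]
  have h1 : 0 ≤ (N : ℝ) * (ω ^ 2 * P) := by positivity
  have h2 : 0 ≤ (N : ℝ) * m := by positivity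
  simp only [c]
  linarith

end
end

section
/- Two-variable potential bound used for the interaction terms: Let W : ℝ → ℝ be integrable. Then for every Schwartz function ψ on ℝ², | ∬_{ℝ²} W(x₁ − x₂) |ψ(x₁,x₂)|² dx₁ dx₂ | ≤ 2 ‖W‖_{L¹(ℝ)} ‖∂_{x₁} ψ‖_{L²(ℝ²)} ‖ψ‖_{L²(ℝ²)}. -/
open MeasureTheory

noncomputable section

open Set in
/-- An integrable function with integrable derivative is bounded by the `L¹` norm of
its derivative. -/
theorem le_integral_of_hasDerivAt_of_abs_le {f f' g : ℝ → ℝ} (hf : ∀ x, HasDerivAt f (f' x) x)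
    (hfi : Integrable f) (hf'i : Integrable f') (hg : Integrable g) (hle : ∀ x, |f' x| ≤ g x)
    (x : ℝ) : f x ≤ ∫ t, g t := by
  have hlim := tendsto_zero_of_hasDerivAt_of_integrableOn_Iic (a := x) (fun t _ => hf t)
    hf'i.integrableOn hfi.integrableOn
  have hftc := integral_Iic_of_hasDerivAt_of_tendsto' (a := x) (fun t _ => hf t)
    hf'i.integrableOn hlim
  calc f x = ∫ t in Iic x, f' t := by rw [hftc, sub_zero]
    _ ≤ ∫ t in Iic x, g t :=
      integral_mono hf'i.integrableOn hg.integrableOn fun t => (le_abs_self _).trans (hle t)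
    _ ≤ ∫ t, g t :=
      setIntegral_le_integral hg (.of_forall fun t => (abs_nonneg _).trans (hle t))

/-- The one-dimensional Agmon inequality for the first variable, on almost every line. -/
theorem ae_norm_sq_le_integral_slice {ψ φ : ℝ × ℝ → ℂ} (hψ : MemLp ψ 2) (hφ : MemLp φ 2)
    (hφc : Continuous φ) (hd : ∀ x y, HasDerivAt (fun t => ψ (t, y)) (φ (x, y)) x) :
    ∀ᵐ y : ℝ, ∀ x : ℝ, ‖ψ (x, y)‖ ^ 2 ≤ ∫ t : ℝ, 2 * (‖ψ (t, y)‖ * ‖φ (t, y)‖) := by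
  have hsq := hψ.integrable_norm_pow (by norm_num)
  have hmul : Integrable (fun p : ℝ × ℝ => 2 * (‖ψ p‖ * ‖φ p‖)) :=
    (hψ.norm.integrable_mul hφ.norm).const_mul 2
  filter_upwards [hsq.prod_left_ae, hmul.prod_left_ae] with y hy hy' x
  have hle (t : ℝ) : |2 * inner ℝ (ψ (t, y)) (φ (t, y))| ≤ 2 * (‖ψ (t, y)‖ * ‖φ (t, y)‖) := by
    rw [abs_mul, abs_two]
    gcongr
    exact abs_real_inner_le_norm _ _
  have hc : Continuous fun t => ψ (t, y) :=
    continuous_iff_continuousAt.2 fun t => (hd t y).continuousAt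
  have hc' : Continuous fun t : ℝ => (2 * inner ℝ (ψ (t, y)) (φ (t, y)) : ℝ) :=
    continuous_const.mul (hc.inner (by fun_prop))
  exact le_integral_of_hasDerivAt_of_abs_le (fun t => (hd t y).norm_sq) hy
    (hy'.mono' hc'.aestronglyMeasurable (.of_forall hle)) hy' hle x

/-- Integrating a function of `x₁ - x₂` against a density dominated by a function of `x₂`. -/
theorem abs_integral_mul_le_of_ae_le {W H : ℝ → ℝ} {F : ℝ × ℝ → ℝ} (hW : Integrable W)
    (hH : Integrable H) (hF : ∀ᵐ p : ℝ × ℝ, |F p| ≤ H p.2) :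
    |∫ p : ℝ × ℝ, W (p.1 - p.2) * F p| ≤ (∫ y, |W y|) * ∫ y, H y := by
  have hint : Integrable fun p : ℝ × ℝ => H p.2 * |W (p.1 - p.2)| :=
    hH.convolution_integrand (.mul ℝ ℝ) hW.abs
  have hval : ∫ p : ℝ × ℝ, H p.2 * |W (p.1 - p.2)| = (∫ y, H y) * ∫ y, |W y| :=
    (integral_prod _ hint).trans (integral_convolution (.mul ℝ ℝ) hH hW.abs)
  rw [mul_comm, ← hval, ← Real.norm_eq_abs]
  refine norm_integral_le_of_norm_le hint ?_
  filter_upwards [hF] with p hp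
  rw [norm_mul, Real.norm_eq_abs, Real.norm_eq_abs, mul_comm]
  gcongr

theorem integral_norm_mul_norm_le_sqrt_mul_sqrt {α E F : Type*} [MeasurableSpace α]
    [NormedAddCommGroup E] [NormedAddCommGroup F] {μ : Measure α} {f : α → E} {g : α → F}
    (hf : MemLp f 2 μ) (hg : MemLp g 2 μ) :
    ∫ a, ‖f a‖ * ‖g a‖ ∂μ ≤ √(∫ a, ‖f a‖ ^ 2 ∂μ) * √(∫ a, ‖g a‖ ^ 2 ∂μ) := by
  have h := integral_mul_le_Lp_mul_Lq_of_nonneg (μ := μ) Real.HolderConjugate.two_two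
    (.of_forall fun a => norm_nonneg (f a)) (.of_forall fun a => norm_nonneg (g a))
    (by simpa using hf.norm) (by simpa using hg.norm)
  simpa [Real.sqrt_eq_rpow] using h

/-- **Two-variable potential bound used for the interaction terms**:
for integrable `W : ℝ → ℝ` and Schwartz `ψ` on `ℝ²`,
`|∬ W(x₁-x₂) |ψ(x₁,x₂)|² dx₁ dx₂| ≤ 2 ‖W‖_{L¹} ‖∂_{x₁}ψ‖_{L²} ‖ψ‖_{L²}`. -/
theorem two_variable_potential_bound (W : ℝ → ℝ) (hW : Integrable W)
    (ψ : SchwartzMap (ℝ × ℝ) ℂ) :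
    |∫ p : ℝ × ℝ, W (p.1 - p.2) * ‖ψ p‖ ^ 2|
      ≤ 2 * (∫ y : ℝ, |W y|) *
          Real.sqrt (∫ p : ℝ × ℝ, ‖deriv (fun t => ψ (t, p.2)) p.1‖ ^ 2) *
          Real.sqrt (∫ p : ℝ × ℝ, ‖ψ p‖ ^ 2) := by
  set φ : SchwartzMap (ℝ × ℝ) ℂ := LineDeriv.lineDerivOp ((1, 0) : ℝ × ℝ) ψ with hφ_def
  have hd (x y : ℝ) : HasDerivAt (fun t => ψ (t, y)) (φ (x, y)) x := by
    rw [hφ_def, SchwartzMap.lineDerivOp_apply_eq_fderiv]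
    exact (ψ.differentiableAt (x := (x, y))).hasFDerivAt.comp_hasDerivAt x
      ((hasDerivAt_id x).prodMk (hasDerivAt_const x y))
  have hderiv (p : ℝ × ℝ) : deriv (fun t => ψ (t, p.2)) p.1 = φ p := (hd p.1 p.2).deriv
  simp_rw [hderiv]
  have hψ2 : MemLp ψ 2 := ψ.memLp 2
  have hφ2 : MemLp φ 2 := φ.memLp 2
  have hmul : Integrable (fun p : ℝ × ℝ => 2 * (‖ψ p‖ * ‖φ p‖)) :=
    (hψ2.norm.integrable_mul hφ2.norm).const_mul 2
  have hslice : ∀ᵐ p : ℝ × ℝ, |‖ψ p‖ ^ 2| ≤ ∫ t : ℝ, 2 * (‖ψ (t, p.2)‖ * ‖φ (t, p.2)‖) := by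
    filter_upwards [Measure.quasiMeasurePreserving_snd.ae
      (ae_norm_sq_le_integral_slice hψ2 hφ2 φ.continuous hd)] with p hp
    rw [abs_of_nonneg (by positivity)]
    exact hp p.1
  calc _ ≤ (∫ y, |W y|) * ∫ y : ℝ, ∫ t : ℝ, 2 * (‖ψ (t, y)‖ * ‖φ (t, y)‖) :=
        abs_integral_mul_le_of_ae_le hW hmul.integral_prod_right hslice
    _ = 2 * (∫ y, |W y|) * ∫ p : ℝ × ℝ, ‖φ p‖ * ‖ψ p‖ := by
        rw [← integral_prod_symm _ hmul, ← Measure.volume_eq_prod, integral_const_mul]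
        simp_rw [mul_comm ‖ψ _‖]
        ring
    _ ≤ _ := by
        rw [mul_assoc _ (Real.sqrt _)]
        gcongr
        exact integral_norm_mul_norm_le_sqrt_mul_sqrt hφ2 hψ2

end
end
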